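/- arXiv:1710.00537 — 3 statements merged into one kernel-verified Lean document; each statement's English description precedes it below -/
import Mathlib

section
/- Let 0 ≤ q < 1 and let t, T be reals with 0 < t < T. Set σ_T² := (1−q)T and σ_t² := 1/( 1/t + q/((1−q)T) ). For any c ∈ ℝ, if c' := (σ_t²/σ_T²)·c, then c'²/(2σ_t²) ≤ c²/(2σ_T²). Moreover, for all reals x_t, y_T, x_T, the difference between (x_t/t + (y_T + c)/((1−q)T) − x_T/T)/(1/t + q/((1−q)T)) and (x_t/t + y_T/((1−q)T) − x_T/T)/(1/t + q/((1−q)T)) equals exactly c' = (σ_t²/σ_T²)·c. -/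
/-- Quantitative core of the truthfulness result: with `σ_T² = (1−q)T` (market's posterior
variance right after a prediction at `T`) and `σ_t² = 1/(1/t + q/((1−q)T))` (market's prior
variance at `t < T`), a misreport by `c` at time `T` distorts the market's mean at time `t`
by exactly `c' = (σ_t²/σ_T²)·c`, and the later gain `c'²/(2σ_t²)` is at most the earlier
loss `c²/(2σ_T²)`. -/
theorem misreport_gain_le_loss
    (q t T : ℝ) (hq0 : 0 ≤ q) (hq1 : q < 1) (ht : 0 < t) (htT : t < T)
    (σT2 σt2 : ℝ) (hσT2 : σT2 = (1 - q) * T) (hσt2 : σt2 = 1 / (1 / t + q / ((1 - q) * T)))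
    (c c' : ℝ) (hc' : c' = (σt2 / σT2) * c) :
    c' ^ 2 / (2 * σt2) ≤ c ^ 2 / (2 * σT2) ∧
      ∀ xt yT xT : ℝ,
        (xt / t + (yT + c) / ((1 - q) * T) - xT / T) / (1 / t + q / ((1 - q) * T)) -
            (xt / t + yT / ((1 - q) * T) - xT / T) / (1 / t + q / ((1 - q) * T)) =
          (σt2 / σT2) * c := by
  have hT : 0 < T := ht.trans htT
  have hS : 0 < σT2 := hσT2 ▸ mul_pos (sub_pos.2 hq1) hT
  rw [← hσT2] at hσt2 ⊢
  have hD : 0 < 1 / t + q / σT2 := by positivity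
  have hσ : 0 < σt2 := hσt2 ▸ one_div_pos.2 hD
  have hle : σt2 ≤ σT2 := by
    rw [hσt2, one_div_le hD hS]
    have h1 : 1 / σT2 = 1 / T + q / σT2 := by
      have : 1 - q ≠ 0 := (sub_pos.2 hq1).ne'
      rw [hσT2]
      field_simp
      ring
    rw [h1]
    gcongr
  refine ⟨?_, fun xt yT xT => ?_⟩
  · calc c' ^ 2 / (2 * σt2) = c ^ 2 / (2 * σT2) * (σt2 / σT2) := by
          rw [hc']
          field_simp
      _ ≤ c ^ 2 / (2 * σT2) :=
          mul_le_of_le_one_right (by positivity) ((div_le_one hS).2 hle)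
  · rw [hσt2, ← sub_div]
    ring
end

section
/- Let 0 < q < 1 and let t₂, t₁, T be reals with 0 < t₂ < t₁ < T. Set σ² := 1/( 1/t₂ + q/((1−q)T) ). Then −q·(t₁ − t₂)/T + q·(t₁ − t₂)·( 1/(t₁ t₂) + q/((1−q)T²) )·σ² = 1 − ( (1 − q(T − t₁)/T)·(1 − q(t₁ − t₂)/t₁) ) / ( 1 − q(T − t₂)/T ). -/
/-- The algebraic identity `R = S` from the proof of the main theorem: with
`σ² = 1/(1/t₂ + q/((1−q)T))`,
`−q(t₁−t₂)/T + q(t₁−t₂)(1/(t₁t₂) + q/((1−q)T²))σ²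
  = 1 − (1 − q(T−t₁)/T)(1 − q(t₁−t₂)/t₁)/(1 − q(T−t₂)/T)`. -/
theorem R_eq_S
    (q t₂ t₁ T : ℝ) (hq0 : 0 < q) (hq1 : q < 1)
    (ht₂ : 0 < t₂) (h21 : t₂ < t₁) (h1T : t₁ < T)
    (σ2 : ℝ) (hσ2 : σ2 = 1 / (1 / t₂ + q / ((1 - q) * T))) :
    -q * (t₁ - t₂) / T + q * (t₁ - t₂) * (1 / (t₁ * t₂) + q / ((1 - q) * T ^ 2)) * σ2 =
      1 - (1 - q * (T - t₁) / T) * (1 - q * (t₁ - t₂) / t₁) / (1 - q * (T - t₂) / T) := by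
  have ht₁ : 0 < t₁ := ht₂.trans h21
  have hT : 0 < T := ht₁.trans h1T
  have hq : 0 < 1 - q := sub_pos.mpr hq1
  have hD : 0 < (1 - q) * T + q * t₂ := by positivity
  have hσ : σ2 = (1 - q) * T * t₂ / ((1 - q) * T + q * t₂) := by
    rw [hσ2, div_add_div _ _ ht₂.ne' (by positivity), one_div_div]
    ring
  have hden : 1 - q * (T - t₂) / T = ((1 - q) * T + q * t₂) / T := by
    field_simp
    ring
  rw [hσ, hden]
  field_simp
  ring
end

section
/- Let 0 < q < 1 and let t₂, t₁, T be reals with 0 < t₂ < t₁ < T. Set σ_{t₁}² := 1/( 1/t₁ + q/((1−q)T) ) and σ_{t₂}² := 1/( 1/t₂ + q/((1−q)T) ). Then for every real d: (1/σ_{t₁}²)·(1 − σ_{t₂}²/σ_{t₁}²)·d² + q·(t₁ − t₂)/T − q·(t₁ − t₂)·( 1/(t₁ t₂) + q/((1−q)T²) )·σ_{t₂}² − log( (1 − q(T − t₁)/T)·(1 − q(t₁ − t₂)/t₁) / (1 − q(T − t₂)/T) ) > 0. -/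
/-- Key inequality in case (ii) of the main theorem: with
`σ_s² = 1/(1/s + q/((1−q)T))`, for every realized gap `d`,
`(1/σ_{t₁}²)(1 − σ_{t₂}²/σ_{t₁}²)d² + q(t₁−t₂)/T − q(t₁−t₂)(1/(t₁t₂)+q/((1−q)T²))σ_{t₂}²
 − log((1 − q(T−t₁)/T)(1 − q(t₁−t₂)/t₁)/(1 − q(T−t₂)/T)) > 0`. -/
theorem predict_earlier_strictly_better
    (q t₂ t₁ T : ℝ) (hq0 : 0 < q) (hq1 : q < 1)
    (ht₂ : 0 < t₂) (h21 : t₂ < t₁) (h1T : t₁ < T)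
    (σt₁2 σt₂2 : ℝ)
    (hσ1 : σt₁2 = 1 / (1 / t₁ + q / ((1 - q) * T)))
    (hσ2 : σt₂2 = 1 / (1 / t₂ + q / ((1 - q) * T))) (d : ℝ) :
    0 < (1 / σt₁2) * (1 - σt₂2 / σt₁2) * d ^ 2 + q * (t₁ - t₂) / T -
        q * (t₁ - t₂) * (1 / (t₁ * t₂) + q / ((1 - q) * T ^ 2)) * σt₂2 -
        Real.log ((1 - q * (T - t₁) / T) * (1 - q * (t₁ - t₂) / t₁) /
          (1 - q * (T - t₂) / T)) := by
  have hp : 0 < 1 - q := by linarith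
  have ht₁ : 0 < t₁ := by linarith
  have hT : 0 < T := by linarith
  have hD : 0 < (1 - q) * T + q * t₂ := by positivity
  have hσ1_pos : 0 < σt₁2 := by rw [hσ1]; positivity
  have hσ_le : σt₂2 ≤ σt₁2 := by
    rw [hσ1, hσ2]
    gcongr
  have h_gap : 0 ≤ (1 / σt₁2) * (1 - σt₂2 / σt₁2) * d ^ 2 := by
    have : 0 ≤ 1 - σt₂2 / σt₁2 := sub_nonneg.2 ((div_le_one hσ1_pos).2 hσ_le)
    positivity
  have hσ2' : σt₂2 = t₂ * ((1 - q) * T) / ((1 - q) * T + q * t₂) := by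
    rw [hσ2]
    field_simp
  set X := (1 - q * (T - t₁) / T) * (1 - q * (t₁ - t₂) / t₁) / (1 - q * (T - t₂) / T) with hX
  have hX' : X = ((1 - q) * T + q * t₁) * ((1 - q) * t₁ + q * t₂) /
      (t₁ * ((1 - q) * T + q * t₂)) := by
    have e₁ : 1 - q * (T - t₁) / T = ((1 - q) * T + q * t₁) / T := by field_simp; ring
    have e₂ : 1 - q * (t₁ - t₂) / t₁ = ((1 - q) * t₁ + q * t₂) / t₁ := by field_simp; ring
    have e₃ : 1 - q * (T - t₂) / T = ((1 - q) * T + q * t₂) / T := by field_simp; ring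
    rw [hX, e₁, e₂, e₃]
    field_simp
  have hX_pos : 0 < X := by rw [hX']; positivity
  have hX_sub : X - 1 =
      -((1 - q) * q * (T - t₁) * (t₁ - t₂) / (t₁ * ((1 - q) * T + q * t₂))) := by
    rw [hX']
    field_simp
    ring
  have hX_ne : X ≠ 1 := by
    have : 0 < (1 - q) * q * (T - t₁) * (t₁ - t₂) / (t₁ * ((1 - q) * T + q * t₂)) := by
      have := sub_pos.2 h1T
      have := sub_pos.2 h21
      positivity
    intro h
    linarith
  have h_var : q * (t₁ - t₂) / T -
      q * (t₁ - t₂) * (1 / (t₁ * t₂) + q / ((1 - q) * T ^ 2)) * σt₂2 = X - 1 := by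
    rw [hX_sub, hσ2']
    field_simp
    ring
  have h_log := Real.log_lt_sub_one_of_pos hX_pos hX_ne
  linarith
end
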